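/- Let m ≥ 2 and 2 ≤ k ≤ m. Then in the braid group B_m the element push_k commutes with σ_i for every 1 ≤ i ≤ k - 2 and for every k + 1 ≤ i ≤ m - 1. -/

import Mathlib

/-- The braid relations on `m - 1` generators: `PresentedGroup (braidRels m)` is the braid
group `B_m`.  The generator `i : Fin (m - 1)` corresponds to the standard generator
`σ_{i+1}` (in the usual 1-based numbering `σ_1, …, σ_{m-1}`). -/
def braidRels (m : ℕ) : Set (FreeGroup (Fin (m - 1))) :=
  {r | (∃ i j : Fin (m - 1), (i : ℕ) + 1 = (j : ℕ) ∧
          r = FreeGroup.of i * FreeGroup.of j * FreeGroup.of i *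
              (FreeGroup.of j * FreeGroup.of i * FreeGroup.of j)⁻¹) ∨
       (∃ i j : Fin (m - 1), (i : ℕ) + 2 ≤ (j : ℕ) ∧
          r = FreeGroup.of i * FreeGroup.of j * (FreeGroup.of j * FreeGroup.of i)⁻¹)}

/-- The braid group on `m` strands, presented by generators `σ_1, …, σ_{m-1}` with the braid
relations. -/
def BraidGroup (m : ℕ) : Type := PresentedGroup (braidRels m)

instance (m : ℕ) : Group (BraidGroup m) := by unfold BraidGroup; infer_instance

/-- The standard generator `σ_j` of `B_m`, for `1 ≤ j ≤ m - 1` (and junk value `1` otherwise). -/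
def σ (m j : ℕ) : BraidGroup m :=
  if h : 1 ≤ j ∧ j ≤ m - 1 then PresentedGroup.of ⟨j - 1, by omega⟩ else 1

/-- `σ_{[i,j]} = σ_i σ_{i+1} ⋯ σ_j` if `i ≤ j`, and `1` if `i > j`. -/
def σI (m i j : ℕ) : BraidGroup m := ((List.range' i (j + 1 - i)).map (σ m)).prod

/-- `σ̄_{[i,j]} = σ_j σ_{j-1} ⋯ σ_i` if `i ≤ j`, and `1` if `i > j`. -/
def σIrev (m i j : ℕ) : BraidGroup m := ((List.range' i (j + 1 - i)).reverse.map (σ m)).prod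

/-- The Dehn twist braid `twist_k = (σ_{[1,k-1]} σ_1)^{k-1}`. -/
def twist (m k : ℕ) : BraidGroup m := (σI m 1 (k - 1) * σ m 1) ^ (k - 1)

/-- The point-push braid `push_k = σ̄_{[1,k-1]} σ_{[1,k-1]}`. -/
def push (m k : ℕ) : BraidGroup m := σIrev m 1 (k - 1) * σI m 1 (k - 1)

theorem sigma_pos (m j : ℕ) (h : 1 ≤ j ∧ j ≤ m - 1) :
    σ m j = (PresentedGroup.of ⟨j - 1, by omega⟩ : PresentedGroup (braidRels m)) :=
  dif_pos h

theorem sigma_neg (m j : ℕ) (h : ¬ (1 ≤ j ∧ j ≤ m - 1)) : σ m j = 1 :=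
  dif_neg h

theorem sigma_far (m i j : ℕ) (h : i + 2 ≤ j) : σ m i * σ m j = σ m j * σ m i := by
  by_cases h1 : 1 ≤ i ∧ i ≤ m - 1
  swap
  · simp [sigma_neg m i h1]
  by_cases h2 : 1 ≤ j ∧ j ≤ m - 1
  swap
  · simp [sigma_neg m j h2]
  · have hr : (FreeGroup.of (⟨i - 1, by omega⟩ : Fin (m - 1)) * FreeGroup.of ⟨j - 1, by omega⟩ *
        (FreeGroup.of ⟨j - 1, by omega⟩ * FreeGroup.of ⟨i - 1, by omega⟩)⁻¹) ∈ braidRels m :=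
      Or.inr ⟨_, _, by simp only; omega, rfl⟩
    have h3 := PresentedGroup.one_of_mem hr
    rw [map_mul, map_inv, mul_inv_eq_one, map_mul, map_mul] at h3
    rw [sigma_pos m i h1, sigma_pos m j h2]
    exact h3

theorem sigma_braid (m i : ℕ) (h : 1 ≤ i) (h' : i + 1 ≤ m - 1) :
    σ m i * σ m (i + 1) * σ m i = σ m (i + 1) * σ m i * σ m (i + 1) := by
  have hr : (FreeGroup.of (⟨i - 1, by omega⟩ : Fin (m - 1)) *
      FreeGroup.of ⟨i + 1 - 1, by omega⟩ * FreeGroup.of ⟨i - 1, by omega⟩ *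
        (FreeGroup.of ⟨i + 1 - 1, by omega⟩ * FreeGroup.of ⟨i - 1, by omega⟩ *
          FreeGroup.of ⟨i + 1 - 1, by omega⟩)⁻¹) ∈ braidRels m :=
    Or.inl ⟨_, _, by simp only; omega, rfl⟩
  have h3 := PresentedGroup.one_of_mem hr
  rw [map_mul, map_inv, mul_inv_eq_one] at h3
  simp only [map_mul] at h3
  rw [sigma_pos m i (by omega), sigma_pos m (i + 1) (by omega)]
  exact h3

theorem sigmaI_succ (m n : ℕ) : σI m 1 (n + 1) = σI m 1 n * σ m (n + 1) := by
  simp [σI, List.range'_concat, add_comm]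

theorem sigmaIrev_succ (m n : ℕ) : σIrev m 1 (n + 1) = σ m (n + 1) * σIrev m 1 n := by
  simp [σIrev, List.range'_concat, add_comm]

theorem sigmaI_far (m n j : ℕ) (h : n + 2 ≤ j) : Commute (σI m 1 n) (σ m j) := by
  induction n with
  | zero => simp [σI]
  | succ n ih =>
    rw [sigmaI_succ]
    exact (ih (by omega)).mul_left (sigma_far m _ _ (by omega))

theorem sigmaIrev_far (m n j : ℕ) (h : n + 2 ≤ j) : Commute (σIrev m 1 n) (σ m j) := by
  induction n with
  | zero => simp [σIrev]
  | succ n ih =>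
    rw [sigmaIrev_succ]
    exact Commute.mul_left (sigma_far m _ _ (by omega)) (ih (by omega))

theorem sigmaI_shift (m n i : ℕ) (hi : 1 ≤ i) (hn : i + 1 ≤ n) (hm : n ≤ m - 1) :
    σI m 1 n * σ m i = σ m (i + 1) * σI m 1 n := by
  induction n with
  | zero => omega
  | succ n ih =>
    by_cases h : i + 1 ≤ n
    · rw [sigmaI_succ, mul_assoc, ← sigma_far m i (n + 1) (by omega), ← mul_assoc,
        ih h (by omega), mul_assoc]
    · obtain ⟨p, rfl⟩ : ∃ p, n = p + 1 := ⟨n - 1, by omega⟩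
      obtain rfl : i = p + 1 := by omega
      have hb := sigma_braid m (p + 1) hi hm
      have hc := (sigmaI_far m p (p + 1 + 1) (by omega)).eq
      rw [sigmaI_succ, sigmaI_succ]
      simp only [mul_assoc] at hb ⊢
      rw [hb, ← mul_assoc, hc, mul_assoc]

theorem sigmaIrev_shift (m n i : ℕ) (hi : 1 ≤ i) (hn : i + 1 ≤ n) (hm : n ≤ m - 1) :
    σ m i * σIrev m 1 n = σIrev m 1 n * σ m (i + 1) := by
  induction n with
  | zero => omega
  | succ n ih =>
    by_cases h : i + 1 ≤ n
    · rw [sigmaIrev_succ, ← mul_assoc, sigma_far m i (n + 1) (by omega), mul_assoc,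
        ih h (by omega), mul_assoc]
    · obtain ⟨p, rfl⟩ : ∃ p, n = p + 1 := ⟨n - 1, by omega⟩
      obtain rfl : i = p + 1 := by omega
      have hb := sigma_braid m (p + 1) hi hm
      have hc := (sigmaIrev_far m p (p + 1 + 1) (by omega)).eq
      rw [sigmaIrev_succ, sigmaIrev_succ]
      simp only [← mul_assoc] at hb ⊢
      rw [hb, mul_assoc, ← hc, ← mul_assoc]

/-- For `m ≥ 2` and `2 ≤ k ≤ m`, in `B_m` the element `push_k` commutes
with `σ_i` for every `1 ≤ i ≤ k - 2` and every `k + 1 ≤ i ≤ m - 1`. -/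
theorem push_commutes_with_sigma (m k : ℕ) (hm : 2 ≤ m) (hk : 2 ≤ k) (hkm : k ≤ m) :
    ∀ i : ℕ, (1 ≤ i ∧ i ≤ k - 2) ∨ (k + 1 ≤ i ∧ i ≤ m - 1) →
      Commute (push m k) (σ m i) := by 
  rintro i (⟨h1, h2⟩ | ⟨h1, h2⟩)
  · unfold push
    show _ * _ = _ * _
    rw [mul_assoc, sigmaI_shift m (k - 1) i h1 (by omega) (by omega), ← mul_assoc,
      ← sigmaIrev_shift m (k - 1) i h1 (by omega) (by omega), mul_assoc]
  · exact (sigmaIrev_far m (k - 1) i (by omega)).mul_left (sigmaI_far m (k - 1) i (by omega))
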